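/- Fix p ≥ 1 and N ∈ ℕ, N ≥ 1, and let Ψ be the set of functions ψ : ℝ^N → ℝ satisfying |ψ(ξ) − ψ(ξ')| ≤ (1/N)·∑_{k=1}^N c_p(ξ^k, ξ'^k)·|ξ^k − ξ'^k| for all ξ = (ξ¹,…,ξ^N), ξ' = (ξ'¹,…,ξ'^N) ∈ ℝ^N. Then for all Borel probability measures P, Q on ℝ with ∫|t|^p dP < ∞ and ∫|t|^p dQ < ∞, sup_{ψ ∈ Ψ} |∫_{ℝ^N} ψ dP^{⊗N} − ∫_{ℝ^N} ψ dQ^{⊗N}| ≤ d_{FM,p}(P,Q) < ∞. -/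

import Mathlib

open MeasureTheory
open scoped ENNReal

/-- The local Lipschitz growth constant `c_p(x,y) = max{1,|x|,|y|}^(p−1)`. -/
noncomputable def cp (p x y : ℝ) : ℝ := max 1 (max |x| |y|) ^ (p - 1)

/-- The `p`-th order Fortet–Mourier distance between Borel probability measures on `ℝ`. -/
noncomputable def dFM (p : ℝ) (P Q : Measure ℝ) : ℝ≥0∞ :=
  ⨆ ψ ∈ {ψ : ℝ → ℝ | ∀ x y : ℝ, |ψ x - ψ y| ≤ cp p x y * |x - y|},
    ENNReal.ofReal |∫ x, ψ x ∂P - ∫ x, ψ x ∂Q|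

theorem continuous_cp_left {p : ℝ} (hp : 1 ≤ p) (y : ℝ) : Continuous fun x => cp p x y := by
  unfold cp
  exact Continuous.rpow_const (by fun_prop) fun _ => Or.inr (by linarith)

theorem cp_zero_mul_abs_le (p x : ℝ) :
    cp p x 0 * |x - 0| ≤ 1 + |x| ^ p := by
  have hx : (0 : ℝ) ≤ |x| ^ p := by positivity
  unfold cp
  rw [abs_zero, max_eq_left (abs_nonneg x), sub_zero]
  rcases le_total |x| 1 with h | h
  · rw [max_eq_left h, Real.one_rpow]
    linarith
  · have hpos : 0 < |x| := by linarith
    rw [max_eq_right h, Real.rpow_sub_one hpos.ne', div_mul_cancel₀ _ hpos.ne']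
    linarith

theorem continuous_of_abs_sub_le {X : Type*} [TopologicalSpace X] {ψ : X → ℝ} {g : X → X → ℝ}
    (hg : ∀ y, Continuous fun x => g x y) (hg0 : ∀ y, g y y = 0)
    (h : ∀ x y, |ψ x - ψ y| ≤ g x y) : Continuous ψ := by
  refine continuous_iff_continuousAt.2 fun y => ?_
  refine tendsto_iff_dist_tendsto_zero.2 ?_
  refine squeeze_zero (fun _ => dist_nonneg) (fun x => h x y) ?_
  simpa [hg0] using (hg y).tendsto y

theorem integrable_of_abs_sub_le_cp {p : ℝ} (hp : 1 ≤ p) {P : Measure ℝ} [IsProbabilityMeasure P]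
    (hP : Integrable (fun t : ℝ => |t| ^ p) P) {a : ℝ} (ha : 0 ≤ a) {ψ : ℝ → ℝ}
    (h : ∀ x y, |ψ x - ψ y| ≤ a * (cp p x y * |x - y|)) : Integrable ψ P := by
  have hc : Continuous ψ := by
    refine continuous_of_abs_sub_le (g := fun x y => a * (cp p x y * |x - y|))
      (fun y => ?_) (by simp) h
    have := continuous_cp_left hp y
    fun_prop
  refine Integrable.mono' (g := fun x => |ψ 0| + a * (1 + |x| ^ p)) ?_
    hc.aestronglyMeasurable (Filter.Eventually.of_forall fun x => ?_)
  · exact (integrable_const _).add (((integrable_const _).add hP).const_mul a)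
  · have h1 := (h x 0).trans (mul_le_mul_of_nonneg_left (cp_zero_mul_abs_le p x) ha)
    have h2 := abs_sub_abs_le_abs_sub (ψ x) (ψ 0)
    rw [Real.norm_eq_abs]
    linarith

theorem integrable_pi_of_abs_sub_le_cp {p : ℝ} (hp : 1 ≤ p) {n : ℕ} {P : Measure ℝ}
    [IsProbabilityMeasure P] (hP : Integrable (fun t : ℝ => |t| ^ p) P) {a : ℝ} (ha : 0 ≤ a)
    {ψ : (Fin n → ℝ) → ℝ}
    (h : ∀ ξ η, |ψ ξ - ψ η| ≤ a * ∑ k, cp p (ξ k) (η k) * |ξ k - η k|) :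
    Integrable ψ (Measure.pi fun _ : Fin n => P) := by
  have hc : Continuous ψ := by
    refine continuous_of_abs_sub_le (g := fun ξ η => a * ∑ k, cp p (ξ k) (η k) * |ξ k - η k|)
      (fun η => ?_) (by simp) h
    have (k : Fin n) : Continuous fun ξ : Fin n → ℝ => cp p (ξ k) (η k) :=
      (continuous_cp_left hp (η k)).comp (continuous_apply k)
    fun_prop
  refine Integrable.mono' (g := fun ξ => |ψ 0| + a * ∑ k, (1 + |ξ k| ^ p)) ?_
    hc.aestronglyMeasurable (Filter.Eventually.of_forall fun ξ => ?_)
  · refine (integrable_const _).add (Integrable.const_mul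
      (integrable_finsetSum _ fun k _ => (integrable_const _).add ?_) a)
    exact (measurePreserving_eval (fun _ : Fin n => P) k).integrable_comp_of_integrable hP
  · have h1 : a * ∑ k, cp p (ξ k) 0 * |ξ k - 0| ≤ a * ∑ k, (1 + |ξ k| ^ p) :=
      mul_le_mul_of_nonneg_left
        (Finset.sum_le_sum fun k _ => cp_zero_mul_abs_le p (ξ k)) ha
    have h2 := abs_sub_abs_le_abs_sub (ψ ξ) (ψ 0)
    have h3 := h ξ 0
    simp only [Pi.zero_apply] at h3
    rw [Real.norm_eq_abs]
    linarith

theorem dFM_lt_top {p : ℝ} (hp : 1 ≤ p) {P Q : Measure ℝ}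
    [IsProbabilityMeasure P] [IsProbabilityMeasure Q]
    (hP : Integrable (fun t : ℝ => |t| ^ p) P) (hQ : Integrable (fun t : ℝ => |t| ^ p) Q) :
    dFM p P Q < ⊤ := by
  have key : ∀ (M : Measure ℝ) [IsProbabilityMeasure M], Integrable (fun t : ℝ => |t| ^ p) M →
      ∀ ψ : ℝ → ℝ, (∀ x y, |ψ x - ψ y| ≤ cp p x y * |x - y|) →
      |∫ x, ψ x ∂M - ψ 0| ≤ ∫ x, (1 + |x| ^ p) ∂M := by
    intro M _ hM ψ hψ
    have hi : Integrable ψ M := integrable_of_abs_sub_le_cp hp hM zero_le_one (by simpa using hψ)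
    have h0 : ∫ x, ψ x ∂M - ψ 0 = ∫ x, (ψ x - ψ 0) ∂M := by
      simp [integral_sub hi (integrable_const _)]
    rw [h0]
    exact norm_integral_le_of_norm_le (f := fun x => ψ x - ψ 0) (g := fun x => 1 + |x| ^ p)
      ((integrable_const _).add hM)
      (Filter.Eventually.of_forall fun x => (hψ x 0).trans (cp_zero_mul_abs_le p x))
  refine lt_of_le_of_lt (iSup₂_le fun ψ hψ => ?_)
    (ENNReal.ofReal_lt_top (r := ∫ x, (1 + |x| ^ p) ∂P + ∫ x, (1 + |x| ^ p) ∂Q))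
  refine ENNReal.ofReal_le_ofReal ?_
  have h1 := abs_le.1 (key P hP ψ hψ)
  have h2 := abs_le.1 (key Q hQ ψ hψ)
  rw [abs_le]
  constructor <;> linarith [h1.1, h1.2, h2.1, h2.2]

theorem abs_integral_sub_le_mul_dFM {p : ℝ} {P Q : Measure ℝ} (hfin : dFM p P Q < ⊤)
    {a : ℝ} (ha : 0 < a) {ψ : ℝ → ℝ}
    (h : ∀ x y, |ψ x - ψ y| ≤ a * (cp p x y * |x - y|)) :
    |∫ x, ψ x ∂P - ∫ x, ψ x ∂Q| ≤ a * (dFM p P Q).toReal := by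
  have hmem : (fun x => a⁻¹ * ψ x) ∈
      {ψ : ℝ → ℝ | ∀ x y : ℝ, |ψ x - ψ y| ≤ cp p x y * |x - y|} := by
    intro x y
    rw [← mul_sub, abs_mul, abs_of_pos (inv_pos.2 ha), inv_mul_le_iff₀ ha]
    exact h x y
  have hle : ENNReal.ofReal |∫ x, a⁻¹ * ψ x ∂P - ∫ x, a⁻¹ * ψ x ∂Q| ≤ dFM p P Q :=
    le_iSup₂ (f := fun (ψ : ℝ → ℝ) (_ : ψ ∈ {ψ : ℝ → ℝ | ∀ x y : ℝ,
      |ψ x - ψ y| ≤ cp p x y * |x - y|}) => ENNReal.ofReal |∫ x, ψ x ∂P - ∫ x, ψ x ∂Q|) _ hmem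
  rw [ENNReal.ofReal_le_iff_le_toReal hfin.ne, integral_const_mul, integral_const_mul, ← mul_sub,
    abs_mul, abs_of_pos (inv_pos.2 ha), inv_mul_le_iff₀ ha] at hle
  exact hle

theorem integral_pi_succ {n : ℕ} {P : Measure ℝ} [IsProbabilityMeasure P]
    {ψ : (Fin (n + 1) → ℝ) → ℝ} (hψ : Integrable ψ (Measure.pi fun _ : Fin (n + 1) => P)) :
    ∫ ξ, ψ ξ ∂(Measure.pi fun _ : Fin (n + 1) => P) =
      ∫ x, ∫ η, ψ (Fin.cons x η) ∂(Measure.pi fun _ : Fin n => P) ∂P := by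
  have hmp := (measurePreserving_piFinSuccAbove (fun _ : Fin (n + 1) => P) 0).symm
  have hcons : ∀ z : ℝ × (Fin n → ℝ),
      (MeasurableEquiv.piFinSuccAbove (fun _ : Fin (n + 1) => ℝ) 0).symm z
        = Fin.cons z.1 z.2 := fun z => by
    simp [MeasurableEquiv.piFinSuccAbove, Fin.consEquiv]
  have hi := hmp.integrable_comp_of_integrable hψ
  rw [← hmp.integral_comp' ψ]
  refine (integral_prod _ hi).trans ?_
  simp only [Function.comp_apply, hcons]

theorem abs_integral_pi_sub_le {p : ℝ} (hp : 1 ≤ p) {P Q : Measure ℝ}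
    [IsProbabilityMeasure P] [IsProbabilityMeasure Q]
    (hP : Integrable (fun t : ℝ => |t| ^ p) P) (hQ : Integrable (fun t : ℝ => |t| ^ p) Q)
    {a : ℝ} (ha : 0 < a) (n : ℕ) (ψ : (Fin n → ℝ) → ℝ)
    (h : ∀ ξ η, |ψ ξ - ψ η| ≤ a * ∑ k, cp p (ξ k) (η k) * |ξ k - η k|) :
    |∫ ξ, ψ ξ ∂(Measure.pi fun _ : Fin n => P) - ∫ ξ, ψ ξ ∂(Measure.pi fun _ : Fin n => Q)|
      ≤ n * (a * (dFM p P Q).toReal) := by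
  induction n with
  | zero => simp [Measure.pi_of_empty _ (0 : Fin 0 → ℝ)]
  | succ n ih =>
    have hrow : ∀ x (ξ η : Fin n → ℝ), |ψ (Fin.cons x ξ) - ψ (Fin.cons x η)| ≤
        a * ∑ k, cp p (ξ k) (η k) * |ξ k - η k| := fun x ξ η => by
      simpa [Fin.sum_univ_succ] using h (Fin.cons x ξ) (Fin.cons x η)
    have hslice : ∀ (M : Measure ℝ) [IsProbabilityMeasure M],
        Integrable (fun t : ℝ => |t| ^ p) M → ∀ x y,
        |∫ η, ψ (Fin.cons x η) ∂(Measure.pi fun _ : Fin n => M) -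
          ∫ η, ψ (Fin.cons y η) ∂(Measure.pi fun _ : Fin n => M)| ≤
          a * (cp p x y * |x - y|) := by
      intro M _ hM x y
      rw [← integral_sub (integrable_pi_of_abs_sub_le_cp hp hM ha.le (hrow x))
        (integrable_pi_of_abs_sub_le_cp hp hM ha.le (hrow y))]
      have := norm_integral_le_of_norm_le_const (μ := Measure.pi fun _ : Fin n => M)
        (f := fun η => ψ (Fin.cons x η) - ψ (Fin.cons y η)) (C := a * (cp p x y * |x - y|))
        (Filter.Eventually.of_forall fun η => by
          simpa [Fin.sum_univ_succ] using h (Fin.cons x η) (Fin.cons y η))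
      simpa using this
    rw [integral_pi_succ (integrable_pi_of_abs_sub_le_cp hp hP ha.le h),
      integral_pi_succ (integrable_pi_of_abs_sub_le_cp hp hQ ha.le h)]
    have hlast := abs_integral_sub_le_mul_dFM (dFM_lt_top hp hP hQ) ha (hslice Q hQ)
    have hfirst := norm_integral_le_of_norm_le_const (μ := P)
      (f := fun x => ∫ η, ψ (Fin.cons x η) ∂(Measure.pi fun _ : Fin n => P) -
        ∫ η, ψ (Fin.cons x η) ∂(Measure.pi fun _ : Fin n => Q))
      (C := n * (a * (dFM p P Q).toReal))
      (Filter.Eventually.of_forall fun x => ih (fun η => ψ (Fin.cons x η)) (hrow x))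
    rw [integral_sub (integrable_of_abs_sub_le_cp hp hP ha.le (hslice P hP))
      (integrable_of_abs_sub_le_cp hp hP ha.le (hslice Q hQ)), Real.norm_eq_abs,
      probReal_univ, mul_one] at hfirst
    refine (abs_sub_le _ _ _).trans ((add_le_add hfirst hlast).trans_eq ?_)
    push_cast
    ring

/-- For `p ≥ 1`, `N ≥ 1`, and `Ψ` the set of `ψ : ℝ^N → ℝ` with
`|ψ(ξ) − ψ(ξ')| ≤ (1/N)·∑ c_p(ξ^k, ξ'^k)·|ξ^k − ξ'^k|`, and probability measures
`P, Q` on `ℝ` with finite `p`-th absolute moments,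
`sup_{ψ ∈ Ψ} |∫ ψ dP^{⊗N} − ∫ ψ dQ^{⊗N}| ≤ d_{FM,p}(P,Q) < ∞`. -/
theorem product_zeta_metric_le_fortetMourier (p : ℝ) (hp : 1 ≤ p) (N : ℕ) (hN : 1 ≤ N)
    (P Q : Measure ℝ) [IsProbabilityMeasure P] [IsProbabilityMeasure Q]
    (hP : Integrable (fun t : ℝ => |t| ^ p) P) (hQ : Integrable (fun t : ℝ => |t| ^ p) Q) :
    (⨆ ψ ∈ {ψ : (Fin N → ℝ) → ℝ | ∀ ξ ξ' : Fin N → ℝ,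
        |ψ ξ - ψ ξ'| ≤ (1 / (N : ℝ)) * ∑ k, cp p (ξ k) (ξ' k) * |ξ k - ξ' k|},
      ENNReal.ofReal |(∫ ξ, ψ ξ ∂(Measure.pi fun _ : Fin N => P)) -
        ∫ ξ, ψ ξ ∂(Measure.pi fun _ : Fin N => Q)|)
      ≤ dFM p P Q ∧ dFM p P Q < ⊤ := by
  have hN' : (0 : ℝ) < N := by exact_mod_cast hN
  have hfin := dFM_lt_top hp hP hQ
  refine ⟨iSup₂_le fun ψ hψ => ?_, hfin⟩
  rw [ENNReal.ofReal_le_iff_le_toReal hfin.ne]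
  refine (abs_integral_pi_sub_le hp hP hQ (one_div_pos.2 hN') N ψ hψ).trans_eq ?_
  field_simp
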